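/- Let Γ = {Δ₁,…,Δ_N} be a semi-stable simplicial partition of an n-dimensional simplicial integral polytope Δ ⊂ ℝⁿ such that every vertex of Γ is non-singular. Then Γ is balanced: the weight vector of Γ at every vertex of Γ equals (1, …, 1). -/

import Mathlib

open Set

noncomputable section

/-- Cast an integer vector to a real vector. -/
def castVec {n : ℕ} (v : Fin n → ℤ) : Fin n → ℝ := fun i => (v i : ℝ)

/-- Cast a rational vector to a real vector. -/
def castQVec {n : ℕ} (v : Fin n → ℚ) : Fin n → ℝ := fun i => (v i : ℝ)

/-- A rational polytope: the convex hull of finitely many rational points. -/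
def IsRatPolytope {n : ℕ} (P : Set (Fin n → ℝ)) : Prop :=
  ∃ S : Finset (Fin n → ℚ), P = convexHull ℝ (castQVec '' (S : Set (Fin n → ℚ)))

/-- An integral polytope: the convex hull of finitely many lattice points. -/
def IsIntegralPolytope {n : ℕ} (P : Set (Fin n → ℝ)) : Prop :=
  ∃ S : Finset (Fin n → ℤ), P = convexHull ℝ (castVec '' (S : Set (Fin n → ℤ)))

/-- The dimension of a set: the dimension of (the direction of) its affine span. -/
def polyDim {n : ℕ} (P : Set (Fin n → ℝ)) : ℕ :=
  Module.finrank ℝ (vectorSpan ℝ P)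

/-- Faces of a polytope/polyhedron: intersections with supporting hyperplanes, together
with the set itself. -/
def IsFaceOf {n : ℕ} (F P : Set (Fin n → ℝ)) : Prop :=
  F = P ∨ ∃ (f : (Fin n → ℝ) →ₗ[ℝ] ℝ) (c : ℝ),
    (∀ x ∈ P, f x ≤ c) ∧ F = {x ∈ P | f x = c} ∧ F.Nonempty

/-- A vertex is a 0-dimensional (i.e. singleton) face. -/
def IsVertexOf {n : ℕ} (p : Fin n → ℝ) (P : Set (Fin n → ℝ)) : Prop := IsFaceOf {p} P

/-- An edge is a 1-dimensional face. -/
def IsEdgeOf {n : ℕ} (e P : Set (Fin n → ℝ)) : Prop := IsFaceOf e P ∧ polyDim e = 1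

/-- A `k`-dimensional polytope is simplicial if exactly `k` edges meet at each vertex. -/
def IsSimplicial {n : ℕ} (k : ℕ) (P : Set (Fin n → ℝ)) : Prop :=
  ∀ p, IsVertexOf p P → {e | IsEdgeOf e P ∧ p ∈ e}.ncard = k

/-- A simplicial partition of a `k`-dimensional simplicial rational polytope `Δ ⊆ ℝⁿ`:
finitely many `k`-dimensional simplicial rational polytopes whose union is `Δ` and
such that the intersection of any two of them is a (possibly empty) common face. -/
structure SimplicialPartition (n k N : ℕ) (Δ : Set (Fin n → ℝ)) : Type where
  pieces : Fin N → Set (Fin n → ℝ)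
  piece_rat : ∀ j, IsRatPolytope (pieces j)
  piece_dim : ∀ j, polyDim (pieces j) = k
  piece_simplicial : ∀ j, IsSimplicial k (pieces j)
  covers : ⋃ j, pieces j = Δ
  common_face : ∀ i j, i ≠ j → pieces i ∩ pieces j = ∅ ∨
    (IsFaceOf (pieces i ∩ pieces j) (pieces i) ∧ IsFaceOf (pieces i ∩ pieces j) (pieces j))

variable {n k N : ℕ} {Δ : Set (Fin n → ℝ)}

/-- A face of the partition `Γ`: a face of one of the subpolytopes, where the
vertices of `Δ` are excluded as 0-faces. -/
def IsGammaFace (Γ : SimplicialPartition n k N Δ) (σ : Set (Fin n → ℝ)) : Prop :=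
  (∃ j, IsFaceOf σ (Γ.pieces j)) ∧ ∀ v : Fin n → ℝ, σ = {v} → ¬ IsVertexOf v Δ

/-- A vertex of the partition `Γ`: a vertex of some subpolytope which is not a vertex of `Δ`. -/
def IsGammaVertex (Γ : SimplicialPartition n k N Δ) (p : Fin n → ℝ) : Prop :=
  (∃ j, IsVertexOf p (Γ.pieces j)) ∧ ¬ IsVertexOf p Δ

/-- An edge of the partition `Γ`. -/
def IsGammaEdge (Γ : SimplicialPartition n k N Δ) (e : Set (Fin n → ℝ)) : Prop :=
  (∃ j, IsFaceOf e (Γ.pieces j)) ∧ polyDim e = 1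

/-- `Γ` is semi-stable: for each face `σ` of `Γ`, if `τ` is the smallest face of `Δ`
containing `σ`, then exactly `dim τ − dim σ + 1` of the subpolytopes have `σ` as a face. -/
def IsSemiStable (Γ : SimplicialPartition n k N Δ) : Prop :=
  ∀ σ, IsGammaFace Γ σ →
    ∀ τ, IsFaceOf τ Δ → σ ⊆ τ → (∀ τ', IsFaceOf τ' Δ → σ ⊆ τ' → τ ⊆ τ') →
      {j | IsFaceOf σ (Γ.pieces j)}.ncard = polyDim τ - polyDim σ + 1

/-- `v` is the primitive vector of the edge `σ` at its vertex `p`: the shortest nonzero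
lattice vector on the ray from `p` along `σ`. -/
def IsPrimitiveEdgeVector {n : ℕ} (σ : Set (Fin n → ℝ)) (p : Fin n → ℝ) (v : Fin n → ℤ) : Prop :=
  v ≠ 0 ∧ (∃ t : ℝ, 0 < t ∧ p + t • castVec v ∈ σ) ∧
    ∀ w : Fin n → ℤ, w ≠ 0 → (∃ s : ℝ, 0 < s ∧ castVec w = s • castVec v) →
      ∃ m : ℕ, 1 ≤ m ∧ w = (m : ℤ) • v

/-- A vertex `p` of a full-dimensional simplicial integral polytope `P ⊆ ℝⁿ` is non-singular
if the primitive vectors of the `n` edges of `P` at `p` form a `ℤ`-basis of `ℤⁿ`. -/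
def IsNonsingularVertexOf {n : ℕ} (p : Fin n → ℝ) (P : Set (Fin n → ℝ)) : Prop :=
  IsVertexOf p P ∧
  ∃ (e : Fin n → Set (Fin n → ℝ)) (v : Fin n → Fin n → ℤ),
    Function.Injective e ∧
    (∀ i, IsEdgeOf (e i) P ∧ p ∈ e i ∧ IsPrimitiveEdgeVector (e i) p (v i)) ∧
    (∀ e', IsEdgeOf e' P → p ∈ e' → ∃ i, e' = e i) ∧
    Submodule.span ℤ (Set.range v) = ⊤

/-- A non-singular polytope: integral, simplicial, and all vertices non-singular. -/
def IsNonsingularPolytope {n : ℕ} (k : ℕ) (P : Set (Fin n → ℝ)) : Prop :=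
  IsIntegralPolytope P ∧ IsSimplicial k P ∧ ∀ p, IsVertexOf p P → IsNonsingularVertexOf p P

/-- A non-singular partition: `Δ` and all the subpolytopes are integral, and every vertex
of `Γ` is a non-singular vertex of every subpolytope containing it. -/
def IsNonsingularPartition (Γ : SimplicialPartition n k N Δ) : Prop :=
  IsIntegralPolytope Δ ∧ (∀ j, IsIntegralPolytope (Γ.pieces j)) ∧
    ∀ p, IsGammaVertex Γ p → ∀ j, p ∈ Γ.pieces j → IsNonsingularVertexOf p (Γ.pieces j)

/-- An edge of the restricted partition `Γ ∩ τ`. -/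
def IsRestrictedEdge (Γ : SimplicialPartition n k N Δ) (τ σ : Set (Fin n → ℝ)) : Prop :=
  ∃ j, IsFaceOf σ (Γ.pieces j ∩ τ) ∧ polyDim σ = 1

/-- A maximal vertex of `Γ`: a vertex of `Γ` lying in the relative interior of a face of `Δ`
of the largest possible dimension among faces of `Δ` containing vertices of `Γ` in their
relative interiors. -/
def IsMaximalVertex (Γ : SimplicialPartition n k N Δ) (p : Fin n → ℝ) : Prop :=
  IsGammaVertex Γ p ∧ ∃ τ, IsFaceOf τ Δ ∧ p ∈ intrinsicInterior ℝ τ ∧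
    ∀ (q : Fin n → ℝ) (τ' : Set (Fin n → ℝ)), IsGammaVertex Γ q → IsFaceOf τ' Δ →
      q ∈ intrinsicInterior ℝ τ' → polyDim τ' ≤ polyDim τ

/-- `Γ` is balanced: at each vertex `p` of `Γ`, lying in the relative interior of an
`l`-dimensional face `τ` of `Δ`, any relation `∑ wᵢ σᵢ(p) = 0` with positive weights of
gcd 1 among the primitive vectors of the `l+1` edges of `Γ ∩ τ` at `p` has all weights 1. -/
def IsBalanced (Γ : SimplicialPartition n k N Δ) : Prop :=
  ∀ p, IsGammaVertex Γ p → ∀ (l : ℕ) (τ : Set (Fin n → ℝ)),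
    IsFaceOf τ Δ → polyDim τ = l → p ∈ intrinsicInterior ℝ τ →
    ∀ (σ : Fin (l+1) → Set (Fin n → ℝ)) (v : Fin (l+1) → Fin n → ℤ) (w : Fin (l+1) → ℤ),
      Function.Injective σ →
      (∀ i, IsRestrictedEdge Γ τ (σ i) ∧ p ∈ σ i ∧ IsPrimitiveEdgeVector (σ i) p (v i)) →
      (∀ e, IsRestrictedEdge Γ τ e → p ∈ e → ∃ i, e = σ i) →
      (∀ i, 0 < w i) → Finset.univ.gcd w = 1 → (∑ i, w i • v i) = 0 →
      ∀ i, w i = 1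

/-- `Γ` is mildly singular: balanced seim-stable and all maximal vertices are non-singular. -/
def IsMildlySingular (Γ : SimplicialPartition n k N Δ) : Prop :=
  IsBalanced Γ ∧
    ∀ p, IsMaximalVertex Γ p → ∀ j, p ∈ Γ.pieces j → IsNonsingularVertexOf p (Γ.pieces j)

/-- An affine function with rational coefficients. -/
def IsRatAffine {n : ℕ} (f : (Fin n → ℝ) →ᵃ[ℝ] ℝ) : Prop :=
  ∃ (a : Fin n → ℚ) (b : ℚ), ∀ x : Fin n → ℝ, f x = (∑ i, (a i : ℝ) * x i) + (b : ℝ)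

/-- `f = f_{ij,p}`: the affine function vanishing on the hyperplane containing the
`(n−1)`-face `Δᵢ ∩ Δⱼ` of `Γ` and taking value 1 at `p + τ₀(p)`, where `τ₀` is the
(unique) edge of `Γ` at `p` not contained in `Δᵢ`. -/
def IsNormalizedAffine (Γ : SimplicialPartition n k N Δ) (i j : Fin N) (p : Fin n → ℝ)
    (f : (Fin n → ℝ) →ᵃ[ℝ] ℝ) : Prop :=
  (∀ x, x ∈ affineSpan ℝ (Γ.pieces i ∩ Γ.pieces j) → f x = 0) ∧
  ∃ (τ₀ : Set (Fin n → ℝ)) (v : Fin n → ℤ),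
    IsGammaEdge Γ τ₀ ∧ p ∈ τ₀ ∧ ¬ τ₀ ⊆ Γ.pieces i ∧
    IsPrimitiveEdgeVector τ₀ p v ∧ f (p + castVec v) = 1

/-- The data entering the concavity `C(f,p)` of a piecewise affine function at a vertex `p`
of `Γ`: the face `τ` of `Δ` with `p` in its relative interior, the `l+1` edges `σᵢ` of
`Γ ∩ τ` at `p`, their primitive vectors `vᵢ` and subpolytopes `Δ_{jsᵢ}` having `σᵢ` as
an edge. -/
def ConcavityDatum (Γ : SimplicialPartition n k N Δ) (p : Fin n → ℝ) (l : ℕ)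
    (τ : Set (Fin n → ℝ)) (σ : Fin (l+1) → Set (Fin n → ℝ))
    (v : Fin (l+1) → Fin n → ℤ) (js : Fin (l+1) → Fin N) : Prop :=
  IsFaceOf τ Δ ∧ polyDim τ = l ∧ p ∈ intrinsicInterior ℝ τ ∧
  Function.Injective σ ∧
  (∀ i, IsFaceOf (σ i) (Γ.pieces (js i) ∩ τ) ∧ polyDim (σ i) = 1 ∧ p ∈ σ i ∧
    IsPrimitiveEdgeVector (σ i) p (v i)) ∧
  (∀ e, IsRestrictedEdge Γ τ e → p ∈ e → ∃ i, e = σ i)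

/-- The concavity `C(f,p) = ∑ᵢ (fᵢ(p + σᵢ(p)) − fᵢ(p))` of the piecewise affine function
with affine pieces `g j` at the vertex `p`, for given concavity data. -/
def concavitySum (Γ : SimplicialPartition n k N Δ) (g : Fin N → ((Fin n → ℝ) →ᵃ[ℝ] ℝ))
    (p : Fin n → ℝ) {l : ℕ} (v : Fin (l+1) → Fin n → ℤ) (js : Fin (l+1) → Fin N) : ℝ :=
  ∑ i, (g (js i) (p + castVec (v i)) - g (js i) p)

/-- Projection ℝ^{n+1} → ℝⁿ forgetting the 0-th (extra) coordinate. -/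
def projDown {n : ℕ} (z : Fin (n+1) → ℝ) : Fin n → ℝ := fun i => z i.succ

/-- The lifted polyhedron `Δ̃ = {(y,x) ∈ ℝ × Δ : y ≥ F(x)}`. -/
def liftSet {n : ℕ} (Δ : Set (Fin n → ℝ)) (F : (Fin n → ℝ) → ℝ) : Set (Fin (n+1) → ℝ) :=
  {z | projDown z ∈ Δ ∧ F (projDown z) ≤ z 0}

/-- A polyhedron: a finite intersection of closed half-spaces. -/
def IsPolyhedron {m : ℕ} (P : Set (Fin m → ℝ)) : Prop :=
  ∃ (s : ℕ) (a : Fin s → ((Fin m → ℝ) →ₗ[ℝ] ℝ)) (c : Fin s → ℝ),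
    P = {x | ∀ i, a i x ≤ c i}

/-- A face of a face of a rational polytope, the latter cut out by a face of a larger set,
is a face of the polytope. -/
theorem IsFaceOf.of_inter {n : ℕ} {P Q τ G : Set (Fin n → ℝ)} (hP : IsRatPolytope P)
    (hPQ : P ⊆ Q) (hτ : IsFaceOf τ Q) (hG : IsFaceOf G (P ∩ τ)) (hne : G.Nonempty) :
    IsFaceOf G P := by
  rcases hτ with rfl | ⟨f, c, hf, rfl, -⟩
  · rwa [inter_eq_left.2 hPQ] at hG
  · have hF : P ∩ {x ∈ Q | f x = c} = {x ∈ P | f x = c} := by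
      ext x
      exact ⟨fun h => ⟨h.1, h.2.2⟩, fun h => ⟨h.1, hPQ h.1, h.2⟩⟩
    rw [hF] at hG
    rcases hG with rfl | ⟨g, d, hg, rfl, -⟩
    · exact Or.inr ⟨f, c, fun x hx => hf x (hPQ hx), rfl, hne⟩
    · obtain ⟨S, rfl⟩ := hP
      have hev : ∀ᶠ M : ℝ in Filter.atTop, ∀ s ∈ castQVec '' (S : Set (Fin n → ℚ)),
          M * f s + g s ≤ M * c + d := by
        refine (Filter.eventually_all_finite (S.finite_toSet.image _)).2 fun s hs => ?_
        have hsP := subset_convexHull ℝ _ hs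
        rcases (hf s (hPQ hsP)).eq_or_lt with h | h
        · refine Filter.Eventually.of_forall fun M => ?_
          have := hg s ⟨hsP, h⟩
          rw [h]
          linarith
        · filter_upwards [Filter.eventually_ge_atTop ((g s - d) / (c - f s))] with M hM
          rw [div_le_iff₀ (by linarith)] at hM
          linarith
      obtain ⟨M, hM⟩ := hev.exists
      have hle : ∀ x ∈ convexHull ℝ (castQVec '' (S : Set (Fin n → ℚ))),
          M * f x + g x ≤ M * c + d := by
        have hconv : Convex ℝ {x | (M • f + g) x ≤ M * c + d} :=
          convex_halfSpace_le (M • f + g).isLinear _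
        intro x hx
        exact convexHull_min (fun s hs => by simpa using hM s hs) hconv hx
      refine Or.inr ⟨(M + 1) • f + g, (M + 1) * c + d, fun x hx => ?_, ?_, hne⟩
      · have h₁ := hle x hx
        have h₂ := hf x (hPQ hx)
        simp only [LinearMap.add_apply, LinearMap.smul_apply, smul_eq_mul]
        linarith
      · ext x
        simp only [mem_ofPred_eq, LinearMap.add_apply, LinearMap.smul_apply, smul_eq_mul]
        constructor
        · rintro ⟨⟨hx, h₁⟩, h₂⟩
          exact ⟨hx, by rw [h₁, h₂]⟩
        · rintro ⟨hx, h⟩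
          have h₁ := hle x hx
          have h₂ := hf x (hPQ hx)
          have h₃ : f x = c := by linarith
          rw [h₃] at h
          exact ⟨⟨hx, h₃⟩, by linarith⟩

theorem IsFaceOf.subset {n : ℕ} {F P : Set (Fin n → ℝ)} (h : IsFaceOf F P) : F ⊆ P := by
  rcases h with rfl | ⟨f, c, -, rfl, -⟩
  · exact subset_rfl
  · exact fun x hx => hx.1

/-- A face meeting the relative interior of a subset contains that subset. -/
theorem IsFaceOf.subset_of_mem_intrinsicInterior {n : ℕ} {F P A : Set (Fin n → ℝ)}
    {p : Fin n → ℝ} (hF : IsFaceOf F P) (hA : A ⊆ P) (hpF : p ∈ F)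
    (hp : p ∈ intrinsicInterior ℝ A) : A ⊆ F := by
  rcases hF with rfl | ⟨f, c, hf, rfl, -⟩
  · exact hA
  · intro x hx
    refine ⟨hA hx, ?_⟩
    obtain ⟨y, hy, rfl⟩ := mem_intrinsicInterior.1 hp
    let g : ℝ → affineSpan ℝ A := fun t =>
      ⟨AffineMap.lineMap (y : Fin n → ℝ) x t,
        AffineMap.lineMap_mem t y.2 (subset_affineSpan ℝ A hx)⟩
    have hg : Continuous g := by
      refine Continuous.subtype_mk ?_ _
      exact AffineMap.lineMap_continuous
    have hg0 : g 0 = y := Subtype.ext (by simp [g])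
    have hev : ∀ᶠ t in nhds (0 : ℝ), (g t : Fin n → ℝ) ∈ A := by
      have h := hg.continuousAt (x := 0)
      rw [ContinuousAt, hg0] at h
      exact h.eventually (mem_interior_iff_mem_nhds.1 hy)
    obtain ⟨ε, hε, hb⟩ := Metric.eventually_nhds_iff.1 hev
    have hmem := hb (y := -(ε / 2)) (by
      rw [Real.dist_eq, sub_zero, abs_neg, abs_of_pos (by linarith)]
      linarith)
    have h₁ := hf _ (hA hmem)
    have h₂ := hf x (hA hx)
    have h₃ : f y = c := hpF.2
    simp only [g, AffineMap.lineMap_apply, vsub_eq_sub, vadd_eq_add, map_add, map_smul, map_sub,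
      smul_eq_mul, h₃] at h₁
    nlinarith

theorem polyDim_mono {n : ℕ} {A B : Set (Fin n → ℝ)} (h : A ⊆ B) : polyDim A ≤ polyDim B :=
  Submodule.finrank_mono (vectorSpan_mono ℝ h)

@[simp]
theorem polyDim_singleton {n : ℕ} (p : Fin n → ℝ) : polyDim {p} = 0 := by
  simp [polyDim]

theorem nonempty_of_polyDim_eq_one {n : ℕ} {A : Set (Fin n → ℝ)} (h : polyDim A = 1) :
    A.Nonempty := by
  rw [nonempty_iff_ne_empty]
  rintro rfl
  rw [polyDim, vectorSpan_empty, finrank_bot] at h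
  exact zero_ne_one h

theorem castVec_injective {n : ℕ} : Function.Injective (castVec (n := n)) := fun v w h =>
  funext fun i => by simpa [castVec] using congrFun h i

theorem castVec_ne_zero {n : ℕ} {v : Fin n → ℤ} (hv : v ≠ 0) : castVec v ≠ 0 := fun h =>
  hv (castVec_injective (h.trans (by ext; simp [castVec])))

/-- The primitive vector of an edge at a vertex is unique. -/
theorem IsPrimitiveEdgeVector.unique {n : ℕ} {P σ : Set (Fin n → ℝ)} {p : Fin n → ℝ}
    {v v' : Fin n → ℤ} (hp : IsVertexOf p P) (hσP : σ ⊆ P) (hpσ : p ∈ σ) (hdim : polyDim σ = 1)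
    (hv : IsPrimitiveEdgeVector σ p v) (hv' : IsPrimitiveEdgeVector σ p v') : v = v' := by
  obtain ⟨hv0, ⟨t, ht, htσ⟩, hvm⟩ := hv
  obtain ⟨hv0', ⟨t', ht', htσ'⟩, hvm'⟩ := hv'
  obtain ⟨f, hf, hf'⟩ : ∃ f : (Fin n → ℝ) →ₗ[ℝ] ℝ, f (castVec v) < 0 ∧ f (castVec v') < 0 := by
    have key : ∀ (u : Fin n → ℤ) (s : ℝ), u ≠ 0 → 0 < s → p + s • castVec u ≠ p := by
      intro u s hu hs h
      rw [add_eq_left, smul_eq_zero] at h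
      exact h.elim hs.ne' (castVec_ne_zero hu)
    rcases hp with h | ⟨f, c, hf, h, -⟩
    · exact absurd (h ▸ hσP htσ : _ ∈ ({p} : Set _)) (key v t hv0 ht)
    · have hpc : f p = c := (h ▸ mem_singleton p : p ∈ {x ∈ P | f x = c}).2
      have neg : ∀ (u : Fin n → ℤ) (s : ℝ), u ≠ 0 → 0 < s → p + s • castVec u ∈ σ →
          f (castVec u) < 0 := by
        intro u s hu hs hmem
        have hlt : f (p + s • castVec u) < c := by
          refine lt_of_le_of_ne (hf _ (hσP hmem)) fun heq => key u s hu hs ?_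
          have : p + s • castVec u ∈ ({p} : Set _) := h ▸ ⟨hσP hmem, heq⟩
          exact this
        rw [map_add, map_smul, smul_eq_mul, hpc] at hlt
        by_contra! hcon
        nlinarith
      exact ⟨f, neg v t hv0 ht htσ, neg v' t' hv0' ht' htσ'⟩
  have hmemspan : ∀ (u : Fin n → ℤ) (s : ℝ), 0 < s → p + s • castVec u ∈ σ →
      castVec u ∈ vectorSpan ℝ σ := by
    intro u s hs hmem
    have h := vsub_mem_vectorSpan ℝ hmem hpσ
    rw [vsub_eq_sub, add_sub_cancel_left] at h
    exact (Submodule.smul_mem_iff _ hs.ne').1 h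
  obtain ⟨r, hr⟩ : ∃ r : ℝ, r • castVec v = castVec v' := by
    have h := (finrank_eq_one_iff_of_nonzero' (K := ℝ)
      (⟨castVec v, hmemspan v t ht htσ⟩ : vectorSpan ℝ σ)
      (fun h => castVec_ne_zero hv0 (congrArg Subtype.val h))).1 hdim
      ⟨castVec v', hmemspan v' t' ht' htσ'⟩
    obtain ⟨r, hr⟩ := h
    exact ⟨r, congrArg Subtype.val hr⟩
  have hrpos : 0 < r := by
    rw [← hr, map_smul, smul_eq_mul] at hf'
    by_contra! hcon
    nlinarith
  obtain ⟨m, -, hm⟩ := hvm v' hv0' ⟨r, hrpos, hr.symm⟩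
  obtain ⟨m', -, hm'⟩ := hvm' v hv0 ⟨r⁻¹, inv_pos.2 hrpos, by
    rw [← hr, smul_smul, inv_mul_cancel₀ hrpos.ne', one_smul]⟩
  have hmm : ((m' : ℤ) * m) • v = (1 : ℤ) • v := by
    rw [mul_smul, ← hm, ← hm', one_smul]
  have h1 : (m' : ℤ) * m = 1 := smul_left_injective ℤ hv0 hmm
  have hm1 : m = 1 := Nat.eq_one_of_mul_eq_one_left (m := m') (by exact_mod_cast h1)
  simpa [hm1] using hm.symm

/-- At a non-singular vertex, the primitive vectors of distinct edges admit dual integral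
linear forms. -/
theorem IsNonsingularVertexOf.exists_dual {n : ℕ} {ι : Type*} {P : Set (Fin n → ℝ)}
    {p : Fin n → ℝ} (hp : IsNonsingularVertexOf p P) {σ : ι → Set (Fin n → ℝ)}
    {v : ι → Fin n → ℤ} (hσ : Function.Injective σ) (hdim : ∀ i, polyDim (σ i) = 1)
    (hpσ : ∀ i, p ∈ σ i) (hv : ∀ i, IsPrimitiveEdgeVector (σ i) p (v i)) {i : ι}
    (hi : IsFaceOf (σ i) P) :
    ∃ φ : (Fin n → ℤ) →ₗ[ℤ] ℤ, φ (v i) = 1 ∧ ∀ k, k ≠ i → IsFaceOf (σ k) P → φ (v k) = 0 := by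
  obtain ⟨hvert, e, u, he, heu, hall, hspan⟩ := hp
  have hli : LinearIndependent ℤ u :=
    linearIndependent_of_top_le_span_of_card_eq_finrank hspan.ge (by simp)
  let b := Module.Basis.mk hli hspan.ge
  have hedge : ∀ k, IsFaceOf (σ k) P → ∃ a, σ k = e a ∧ v k = b a := by
    intro k hk
    obtain ⟨a, ha⟩ := hall (σ k) ⟨hk, hdim k⟩ (hpσ k)
    refine ⟨a, ha, ?_⟩
    rw [Module.Basis.mk_apply]
    exact (hv k).unique hvert hk.subset (hpσ k) (hdim k) (ha ▸ (heu a).2.2)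
  obtain ⟨a, ha, hva⟩ := hedge i hi
  refine ⟨b.coord a, by simp [hva], fun k hki hk => ?_⟩
  obtain ⟨a', ha', hva'⟩ := hedge k hk
  have hne : a' ≠ a := by
    rintro rfl
    exact hki (hσ (ha'.trans ha.symm))
  simp [hva', hne]

/-- If each of `l + 1` subsets of size `l` of a set of size `l + 1` omits a point, and every point
is omitted by some subset, then every subset omits a point lying in all the others. -/
theorem exists_mem_forall_ne {α : Type*} [Finite α] {l : ℕ} {A : Set α}
    {B : Fin (l + 1) → Set α} (hA : A.ncard = l + 1) (hB : ∀ k, (B k).ncard = l)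
    (hBA : ∀ k, B k ⊆ A) (hcover : ∀ j ∈ A, ∃ k, j ∉ B k) (i : Fin (l + 1)) :
    ∃ j ∈ A, ∀ k, k ≠ i → j ∈ B k := by
  have hone : ∀ k, ∃ a, A \ B k = {a} := fun k => by
    rw [← ncard_eq_one, ncard_sdiff (hBA k), hA, hB k]
    omega
  choose m hm using hone
  have hmA : ∀ k, m k ∈ A := fun k => ((hm k).ge rfl).1
  have hsurj : Function.Surjective fun k => (⟨m k, hmA k⟩ : A) := by
    rintro ⟨j, hj⟩
    obtain ⟨k, hk⟩ := hcover j hj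
    have : j ∈ ({m k} : Set α) := hm k ▸ ⟨hj, hk⟩
    exact ⟨k, Subtype.ext (mem_singleton_iff.1 this).symm⟩
  have hinj := ((Nat.bijective_iff_surjective_and_card _).2
    ⟨hsurj, by rw [Nat.card_fin, Nat.card_coe_set_eq, hA]⟩).1
  refine ⟨m i, hmA i, fun k hk => ?_⟩
  by_contra hcon
  have : m i ∈ ({m k} : Set α) := hm k ▸ ⟨hmA i, hcon⟩
  exact hk (hinj (Subtype.ext (mem_singleton_iff.1 this).symm))

/-- a semi-stable simplicial partition of a simplicial integral polytope all
of whose vertices are non-singular is balanced: the weight vector at every vertex of `Γ`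
is `(1, …, 1)`. -/
theorem balanced_of_nonsingular_vertices {n N : ℕ} (hn : 1 ≤ n) {Δ : Set (Fin n → ℝ)}
    (hΔint : IsIntegralPolytope Δ) (hΔdim : polyDim Δ = n) (hΔsimp : IsSimplicial n Δ)
    (Γ : SimplicialPartition n n N Δ) (hss : IsSemiStable Γ)
    (hpint : ∀ j, IsIntegralPolytope (Γ.pieces j))
    (hns : ∀ p, IsGammaVertex Γ p → ∀ j, p ∈ Γ.pieces j →
      IsNonsingularVertexOf p (Γ.pieces j)) :
    IsBalanced Γ := by
  intro p hp l τ hτ hτl hpτ σ v w hσ hσv _ hw hgcd hsum i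
  have hdim : ∀ k, polyDim (σ k) = 1 := fun k => (hσv k).1.choose_spec.2
  have hpσ : ∀ k, p ∈ σ k := fun k => (hσv k).2.1
  have hprim : ∀ k, IsPrimitiveEdgeVector (σ k) p (v k) := fun k => (hσv k).2.2
  have hstau : ∀ k, σ k ⊆ τ := fun k =>
    (hσv k).1.choose_spec.1.subset.trans inter_subset_right
  have hface : ∀ k, ∃ j, IsFaceOf (σ k) (Γ.pieces j) := fun k => by
    obtain ⟨j, hj, h1⟩ := (hσv k).1
    exact ⟨j, IsFaceOf.of_inter (Γ.piece_rat j) ((subset_iUnion Γ.pieces j).trans Γ.covers.le) hτ hj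
      (nonempty_of_polyDim_eq_one h1)⟩
  have hl : 1 ≤ l := by
    rw [← hτl, ← hdim i]
    exact polyDim_mono (hstau i)
  have hmin : ∀ τ', IsFaceOf τ' Δ → p ∈ τ' → τ ⊆ τ' := fun τ' hτ' h =>
    hτ'.subset_of_mem_intrinsicInterior hτ.subset h hpτ
  have hA : {j | IsFaceOf {p} (Γ.pieces j)}.ncard = l + 1 := by
    rw [hss {p} ⟨hp.1, fun q hq => singleton_injective hq ▸ hp.2⟩ τ hτ
      (singleton_subset_iff.2 (intrinsicInterior_subset hpτ))
      fun τ' h h' => hmin τ' h (singleton_subset_iff.1 h')]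
    simp [hτl]
  have hB : ∀ k, {j | IsFaceOf (σ k) (Γ.pieces j)}.ncard = l := fun k => by
    rw [hss (σ k) ⟨hface k, fun q hq => ?_⟩ τ hτ (hstau k) fun τ' h h' => hmin τ' h (h' (hpσ k)),
      hτl, hdim k]
    · omega
    · have := hdim k
      simp [hq] at this
  have happly : ∀ φ : (Fin n → ℤ) →ₗ[ℤ] ℤ, ∑ k, w k * φ (v k) = 0 := fun φ => by
    simpa only [map_sum, map_zsmul, smul_eq_mul, map_zero] using congrArg φ hsum
  obtain ⟨j, hjA, hj⟩ := exists_mem_forall_ne hA hB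
    (fun k j hj => (hns p hp j (hj.subset (hpσ k))).1)
    (fun j hjA => by
      by_contra! hcon
      obtain ⟨φ, h1, h0⟩ := (hns p hp j (hjA.subset rfl)).exists_dual hσ hdim hpσ hprim (hcon i)
      have h := happly φ
      rw [Finset.sum_eq_single i (fun k _ hk => by rw [h0 k hk (hcon k), mul_zero]) (by simp),
        h1, mul_one] at h
      exact (hw i).ne' h) i
  have hdvd : ∀ k, w i ∣ w k := fun k => by
    rcases eq_or_ne k i with rfl | hk
    · exact dvd_rfl
    obtain ⟨φ, h1, h0⟩ := (hns p hp j (hjA.subset rfl)).exists_dual hσ hdim hpσ hprim (hj k hk)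
    have h := happly φ
    rw [Fintype.sum_eq_add k i hk fun a ha => by rw [h0 a ha.1 (hj a ha.2), mul_zero],
      h1, mul_one] at h
    exact ⟨-φ (v i), by linarith⟩
  exact Int.eq_one_of_dvd_one (hw i).le (hgcd ▸ Finset.dvd_gcd fun k _ => hdvd k)
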